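/- Let σ : ℝ → ℝ be smooth, positive, L-periodic, with E = ∫₀ᴸ σ'²/σ² ds. Suppose σ attains the value π^{-2/3} A^{2/3} at some point for a given A > 0, and that ∫₀ᴸ σ^{-2} ds ≤ 2π² A^{-1}. Then σ(s) ≥ ( (√2/2) π A^{-1/2} E^{1/2} + π^{2/3} A^{-2/3} )^{-1} for every s. -/

import Mathlib

open Real

/-- A periodic `C¹` function rises from one point to another by at most half its total variation
over a period. -/
theorem two_mul_sub_le_integral_abs_deriv_of_periodic {f : ℝ → ℝ} {L : ℝ} (hL : 0 < L)
    (hf : ContDiff ℝ 1 f) (hper : Function.Periodic f L) (s x : ℝ) :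
    2 * (f s - f x) ≤ ∫ t in (0:ℝ)..L, |deriv f t| := by
  have hd : Continuous (deriv f) := hf.continuous_deriv le_rfl
  have hdiff : Differentiable ℝ f := hf.differentiable one_ne_zero
  have hdper : Function.Periodic (fun t => |deriv f t|) L := fun t => by
    have h : (fun y => f (y + L)) = f := funext hper
    have h' := deriv_comp_add_const f L t
    rw [h] at h'
    simp only [h']
  have ftc (a b : ℝ) : ∫ t in a..b, deriv f t = f b - f a :=
    intervalIntegral.integral_deriv_eq_sub (fun y _ => hdiff y) (hd.intervalIntegrable a b)
  obtain ⟨y, ⟨hxy, hyL⟩, hy⟩ := hper.exists_mem_Ico hL s x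
  have h₁ := intervalIntegral.abs_integral_le_integral_abs (f := deriv f)
    (μ := MeasureTheory.volume) hxy
  have h₂ := intervalIntegral.abs_integral_le_integral_abs (f := deriv f)
    (μ := MeasureTheory.volume) hyL.le
  rw [ftc] at h₁ h₂
  rw [hper x] at h₂
  have hadd := intervalIntegral.integral_add_adjacent_intervals
    (hd.abs.intervalIntegrable (μ := MeasureTheory.volume) x y)
    (hd.abs.intervalIntegrable y (x + L))
  have hshift := hdper.intervalIntegral_add_eq 0 x
  rw [zero_add] at hshift
  rw [hshift, ← hadd, hy]
  linarith [le_abs_self (f y - f x), neg_abs_le (f x - f y)]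

/-- The Cauchy–Schwarz inequality for interval integrals of continuous functions. -/
theorem sq_intervalIntegral_mul_le {u v : ℝ → ℝ} (hu : Continuous u) (hv : Continuous v)
    {a b : ℝ} (hab : a ≤ b) :
    (∫ t in a..b, u t * v t) ^ 2 ≤ (∫ t in a..b, u t ^ 2) * ∫ t in a..b, v t ^ 2 := by
  have key (r : ℝ) : 0 ≤ (∫ t in a..b, u t ^ 2) * (r * r) + (2 * ∫ t in a..b, u t * v t) * r
      + ∫ t in a..b, v t ^ 2 := by
    have h : 0 ≤ ∫ t in a..b, (r * u t + v t) ^ 2 :=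
      intervalIntegral.integral_nonneg hab fun t _ => sq_nonneg _
    have e : (∫ t in a..b, (r * u t + v t) ^ 2)
        = ∫ t in a..b, (r * r * u t ^ 2 + 2 * r * (u t * v t) + v t ^ 2) := by
      congr 1; ext t; ring
    rw [e, intervalIntegral.integral_add, intervalIntegral.integral_add,
      intervalIntegral.integral_const_mul, intervalIntegral.integral_const_mul] at h
    · linarith
    all_goals exact Continuous.intervalIntegrable (by fun_prop) _ _
  have h := discrim_le_zero key
  unfold discrim at h
  linarith

theorem stmt_9 (σ : ℝ → ℝ) (L : ℝ) (hL : 0 < L)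
    (hσ : ContDiff ℝ (⊤ : ℕ∞) σ)
    (hpos : ∀ s, 0 < σ s)
    (hper : ∀ s, σ (s + L) = σ s)
    (A : ℝ) (hA : 0 < A)
    (E : ℝ) (hE : E = ∫ s in (0:ℝ)..L, (deriv σ s)^2 / (σ s)^2)
    (hval : ∃ x₀, σ x₀ = π ^ (-(2:ℝ)/3) * A ^ ((2:ℝ)/3))
    (hBS : (∫ s in (0:ℝ)..L, (σ s)^(-(2:ℝ))) ≤ 2 * π^2 * A⁻¹) :
    ∀ s, σ s ≥ ((Real.sqrt 2 / 2) * π * A ^ (-(1:ℝ)/2) * E ^ ((1:ℝ)/2)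
        + π ^ ((2:ℝ)/3) * A ^ (-(2:ℝ)/3))⁻¹ := by
  intro s
  obtain ⟨x₀, hx₀⟩ := hval
  have hσ1 : ContDiff ℝ 1 σ := hσ.of_le (by exact_mod_cast le_top)
  have hne (t : ℝ) : σ t ≠ 0 := (hpos t).ne'
  have hd : Continuous (deriv σ) := hσ1.continuous_deriv le_rfl
  have hinv : ContDiff ℝ 1 (fun t => (σ t)⁻¹) := hσ1.inv hne
  have hderiv (t : ℝ) : |deriv (fun t => (σ t)⁻¹) t| = |deriv σ t / σ t| * (σ t)⁻¹ := by
    have h := ((hσ1.differentiable one_ne_zero t).hasDerivAt.fun_inv (hne t)).deriv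
    rw [h, abs_div, abs_div, abs_neg, abs_of_pos (hpos t), abs_of_pos (pow_pos (hpos t) 2)]
    field_simp
  have hvar := two_mul_sub_le_integral_abs_deriv_of_periodic hL hinv
    (fun t => by simp only [hper]) s x₀
  simp only [hderiv] at hvar
  have hCS := sq_intervalIntegral_mul_le (u := fun t => |deriv σ t / σ t|)
    (v := fun t => (σ t)⁻¹) (hd.div₀ hσ1.continuous hne).abs hinv.continuous hL.le
  have hEint : (∫ t in (0:ℝ)..L, |deriv σ t / σ t| ^ 2) = E := by
    simp only [hE, sq_abs, div_pow]
  have hJ : (∫ t in (0:ℝ)..L, (σ t)⁻¹ ^ 2) ≤ 2 * π ^ 2 * A⁻¹ := by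
    convert hBS using 3 with t
    rw [rpow_neg (hpos t).le, rpow_two, inv_pow]
  have hE0 : 0 ≤ E := hEint ▸ intervalIntegral.integral_nonneg hL.le fun t _ => sq_nonneg _
  rw [hEint] at hCS
  have hx₀inv : (σ x₀)⁻¹ = π ^ ((2:ℝ)/3) * A ^ (-(2:ℝ)/3) := by
    rw [hx₀, mul_inv, ← rpow_neg pi_pos.le, ← rpow_neg hA.le]
    norm_num [neg_div]
  have hA2 : (A ^ (-(1:ℝ)/2)) ^ 2 = A⁻¹ := by
    rw [← rpow_natCast, ← rpow_mul hA.le]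
    norm_num [rpow_neg_one]
  have hE2 : (E ^ ((1:ℝ)/2)) ^ 2 = E := by
    rw [← sqrt_eq_rpow, sq_sqrt hE0]
  set K := Real.sqrt 2 / 2 * π * A ^ (-(1:ℝ)/2) * E ^ ((1:ℝ)/2) with hK
  have hK0 : 0 ≤ K := by positivity
  have hK2 : (2 * K) ^ 2 = E * (2 * π ^ 2 * A⁻¹) := by
    simp only [hK, mul_pow, div_pow, hA2, hE2, sq_sqrt zero_le_two]
    ring
  have hB := abs_le_of_sq_le_sq' (hCS.trans ((mul_le_mul_of_nonneg_left hJ hE0).trans hK2.ge))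
    (by positivity)
  refine inv_le_of_inv_le₀ (hpos s) ?_
  rw [← hx₀inv]
  linarith [hB.2]
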